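/- Let α ≥ 1/2, θ₀ ∈ ℝ, and let f : (0,1) → [0,∞) satisfy f(γ)/(log(1/(1−γ)))^{1/α} → 0 as γ → 1⁻. Then for every constant c₀ > 0 there exists γ₀ ∈ (0,1) such that for every γ ∈ [γ₀,1) and every θ ∈ [θ₀−f(γ), θ₀+f(γ)], one has |S*(θ,γ) − S*(θ₀,γ) − (θ−θ₀)| ≤ c₀·|θ−θ₀|. -/

import Mathlib

open MeasureTheory Filter Set Topology

/-- Normalization constant `C₀ = (∫ exp(-|x|^α) dx)⁻¹`. -/
noncomputable def C0 (α : ℝ) : ℝ := (∫ x : ℝ, Real.exp (-(|x| ^ α)))⁻¹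

/-- Density `f_θ(x) = C₀ exp(-|x-θ|^α)`. -/
noncomputable def fd (α θ x : ℝ) : ℝ := C0 α * Real.exp (-(|x - θ| ^ α))

/-- Tail probability `P_θ(S) = ∫_S^∞ f_θ(x) dx`. -/
noncomputable def Ptail (α θ S : ℝ) : ℝ := ∫ x in Set.Ioi S, fd α θ x

/-- Conditional mean above `S`: `μ_θ(S) = (∫_S^∞ x f_θ(x) dx) / P_θ(S)`. -/
noncomputable def muTail (α θ S : ℝ) : ℝ := (∫ x in Set.Ioi S, x * fd α θ x) / Ptail α θ S

/-- `g_θ(S) = P_θ(S) / ∫_S^∞ P_θ(x) dx`. -/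
noncomputable def gfun (α θ S : ℝ) : ℝ := Ptail α θ S / ∫ x in Set.Ioi S, Ptail α θ x

/-- Hazard rate `h_θ(S) = f_θ(S)/P_θ(S)`. -/
noncomputable def hazard (α θ S : ℝ) : ℝ := fd α θ S / Ptail α θ S

/-- The iterated tail `∫_S^∞ P_0(x) dx` of the centred distribution. -/
noncomputable def iteratedTail (α S : ℝ) : ℝ := ∫ x in Set.Ioi S, Ptail α 0 x

lemma setIntegral_Ioi_comp_sub_right (g : ℝ → ℝ) (a c : ℝ) :
    ∫ x in Set.Ioi a, g (x - c) = ∫ x in Set.Ioi (a - c), g x := by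
  rw [← integral_indicator measurableSet_Ioi, ← integral_indicator measurableSet_Ioi,
    ← integral_sub_right_eq_self ((Set.Ioi (a - c)).indicator g) c]
  congr 1 with x
  simp [Set.indicator]

lemma Ptail_eq_Ptail_zero (α θ S : ℝ) : Ptail α θ S = Ptail α 0 (S - θ) := by
  simpa [Ptail, fd] using setIntegral_Ioi_comp_sub_right (fd α 0) S θ

lemma setIntegral_Ptail_eq (α θ S : ℝ) :
    ∫ x in Set.Ioi S, Ptail α θ x = iteratedTail α (S - θ) := by
  rw [iteratedTail, ← setIntegral_Ioi_comp_sub_right]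
  simp_rw [← Ptail_eq_Ptail_zero]

lemma integral_exp_neg_abs_rpow_pos {α : ℝ} (hα : 0 < α) :
    0 < ∫ x : ℝ, Real.exp (-(|x| ^ α)) := by
  rw [integral_comp_abs (f := fun x => Real.exp (-(x ^ α))), integral_exp_neg_rpow hα]
  have := Real.Gamma_pos_of_pos (show 0 < 1 / α + 1 by positivity)
  positivity

lemma C0_pos {α : ℝ} (hα : 0 < α) : 0 < C0 α :=
  inv_pos.2 (integral_exp_neg_abs_rpow_pos hα)

lemma fd_nonneg {α : ℝ} (hα : 0 < α) (θ x : ℝ) : 0 ≤ fd α θ x :=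
  mul_nonneg (C0_pos hα).le (Real.exp_pos _).le

lemma integrable_fd_zero {α : ℝ} (hα : 0 < α) : Integrable (fd α 0) := by
  have h := Integrable.of_integral_ne_zero (integral_exp_neg_abs_rpow_pos hα).ne'
  have hfd : fd α 0 = fun x => C0 α * Real.exp (-(|x| ^ α)) := by
    ext x
    simp [fd]
  exact hfd ▸ h.const_mul (C0 α)

lemma Ptail_nonneg {α : ℝ} (hα : 0 < α) (θ S : ℝ) : 0 ≤ Ptail α θ S :=
  integral_nonneg fun x => fd_nonneg hα θ x

lemma Ptail_zero_antitone {α : ℝ} (hα : 0 < α) : Antitone (Ptail α 0) := fun _ _ h =>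
  setIntegral_mono_set (integrable_fd_zero hα).integrableOn
    (Eventually.of_forall fun x => fd_nonneg hα 0 x) (Ioi_subset_Ioi h).eventuallyLE

lemma fd_zero_mul_le {α v x l N : ℝ} (hα : 0 < α) (hv : 0 < v) (hvx : v ≤ x) (hl : 1 ≤ l)
    (hN : N ≤ α * v ^ α) : fd α 0 (l * x) ≤ l ^ (-N) * fd α 0 x := by
  have hl0 : 0 < l := by linarith
  have hx : 0 < x := by linarith
  have hlog : 0 ≤ Real.log l := Real.log_nonneg hl
  have hpow : v ^ α ≤ x ^ α := Real.rpow_le_rpow hv.le hvx hα.le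
  have hexp : 1 + α * Real.log l ≤ l ^ α := by
    rw [Real.rpow_def_of_pos hl0]
    linarith [Real.add_one_le_exp (Real.log l * α)]
  have hxα : 0 < x ^ α := by positivity
  have key : N * Real.log l + x ^ α ≤ (l * x) ^ α := by
    rw [Real.mul_rpow hl0.le hx.le]
    have h1 : N * Real.log l ≤ α * x ^ α * Real.log l :=
      mul_le_mul_of_nonneg_right (hN.trans (by gcongr)) hlog
    nlinarith [mul_le_mul_of_nonneg_right hexp hxα.le]
  have : Real.exp (-((l * x) ^ α)) ≤ l ^ (-N) * Real.exp (-(x ^ α)) := by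
    rw [Real.rpow_def_of_pos hl0, ← Real.exp_add]
    apply Real.exp_le_exp.2
    linarith
  simp only [fd, sub_zero, abs_of_pos hx, abs_of_pos (mul_pos hl0 hx)]
  nlinarith [mul_le_mul_of_nonneg_left this (C0_pos hα).le]

lemma Ptail_zero_mul_le {α v l N : ℝ} (hα : 0 < α) (hv : 0 < v) (hl : 1 ≤ l)
    (hN : N + 1 ≤ α * v ^ α) : Ptail α 0 (l * v) ≤ l ^ (-N) * Ptail α 0 v := by
  have hl0 : 0 < l := by linarith
  have hint : ∫ x in Set.Ioi v, fd α 0 (l * x) ≤ l ^ (-(N + 1)) * Ptail α 0 v := by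
    rw [Ptail, ← integral_const_mul]
    refine setIntegral_mono_on ((integrable_fd_zero hα).comp_mul_left' hl0.ne').integrableOn
      ((integrable_fd_zero hα).const_mul _).integrableOn measurableSet_Ioi fun x hx => ?_
    exact fd_zero_mul_le hα hv (le_of_lt hx) hl hN
  have hl' : l * l ^ (-(N + 1)) = l ^ (-N) := by
    rw [neg_add, Real.rpow_add hl0, Real.rpow_neg_one]
    field_simp
  calc Ptail α 0 (l * v) = l * ∫ x in Set.Ioi v, fd α 0 (l * x) := by
        rw [Ptail, ← integral_comp_mul_left_Ioi' _ _ hl0, smul_eq_mul]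
    _ ≤ l * (l ^ (-(N + 1)) * Ptail α 0 v) := by gcongr
    _ = l ^ (-N) * Ptail α 0 v := by rw [← mul_assoc, hl']

lemma Ptail_zero_le_rpow {α v x N : ℝ} (hα : 0 < α) (hv : 0 < v) (hvx : v ≤ x)
    (hN : N + 1 ≤ α * v ^ α) :
    Ptail α 0 x ≤ Ptail α 0 v * v ^ N * x ^ (-N) := by
  have hx : 0 < x := hv.trans_le hvx
  have h := Ptail_zero_mul_le hα hv ((one_le_div hv).2 hvx) hN
  rw [div_mul_cancel₀ _ hv.ne', Real.div_rpow hx.le hv.le, Real.rpow_neg hv.le, div_inv_eq_mul] at h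
  linarith

lemma integrableOn_Ioi_Ptail_zero {α : ℝ} (hα : 0 < α) (a : ℝ) :
    IntegrableOn (Ptail α 0) (Set.Ioi a) := by
  have hlim : Tendsto (fun v : ℝ => α * v ^ α) atTop atTop :=
    (tendsto_rpow_atTop hα).const_mul_atTop hα
  obtain ⟨v, hvN, hva, hv⟩ := ((hlim.eventually_ge_atTop (2 + 1)).and
    ((eventually_ge_atTop a).and (eventually_gt_atTop 0))).exists
  have hmeas : Measurable (Ptail α 0) := (Ptail_zero_antitone hα).measurable
  rw [← Ioc_union_Ioi_eq_Ioi hva]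
  refine IntegrableOn.union ?_ ?_
  · exact (((Ptail_zero_antitone hα).antitoneOn _).integrableOn_isCompact
      isCompact_Icc).mono_set Ioc_subset_Icc_self
  · refine Integrable.mono' ((integrableOn_Ioi_rpow_of_lt (a := -2) (by norm_num) hv).const_mul
      (Ptail α 0 v * v ^ (2 : ℝ))) hmeas.aestronglyMeasurable ?_
    filter_upwards [ae_restrict_mem measurableSet_Ioi] with x hx
    rw [Real.norm_of_nonneg (Ptail_nonneg hα 0 x)]
    exact Ptail_zero_le_rpow hα hv (le_of_lt hx) hvN

lemma iteratedTail_le {α v N : ℝ} (hα : 0 < α) (hv : 0 < v) (hN1 : 1 < N)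
    (hN : N + 1 ≤ α * v ^ α) : (N - 1) * iteratedTail α v ≤ v * Ptail α 0 v := by
  have hle : iteratedTail α v ≤ Ptail α 0 v * v ^ N * (-v ^ (-N + 1) / (-N + 1)) := by
    rw [← integral_Ioi_rpow_of_lt (by linarith) hv, ← integral_const_mul]
    exact setIntegral_mono_on (integrableOn_Ioi_Ptail_zero hα v)
      ((integrableOn_Ioi_rpow_of_lt (by linarith) hv).const_mul _) measurableSet_Ioi
      fun x hx => Ptail_zero_le_rpow hα hv (le_of_lt hx) hN
  have hvN : v ^ N * v ^ (-N + 1) = v := by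
    rw [← Real.rpow_add hv]; simp
  have hN0 : 0 < N - 1 := by linarith
  have heq : Ptail α 0 v * v ^ N * (-v ^ (-N + 1) / (-N + 1)) = v * Ptail α 0 v / (N - 1) := by
    rw [show -N + 1 = -(N - 1) by ring, neg_div_neg_eq, ← show -N + 1 = -(N - 1) by ring,
      mul_div_assoc', mul_assoc, hvN, mul_comm]
  rw [heq, le_div_iff₀ hN0] at hle
  linarith

lemma mul_Ptail_le_iteratedTail_sub {α a b : ℝ} (hα : 0 < α) (hab : a ≤ b) :
    (b - a) * Ptail α 0 b ≤ iteratedTail α a - iteratedTail α b := by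
  have hsplit : iteratedTail α a = (∫ x in Set.Ioc a b, Ptail α 0 x) + iteratedTail α b := by
    rw [iteratedTail, ← Ioc_union_Ioi_eq_Ioi hab, setIntegral_union
      (Ioc_disjoint_Ioi le_rfl) measurableSet_Ioi
      ((integrableOn_Ioi_Ptail_zero hα a).mono_set Ioc_subset_Ioi_self)
      (integrableOn_Ioi_Ptail_zero hα b), iteratedTail]
  have hint : ∫ _ in Set.Ioc a b, Ptail α 0 b ≤ ∫ x in Set.Ioc a b, Ptail α 0 x :=
    setIntegral_mono_on (integrableOn_const measure_Ioc_lt_top.ne)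
      ((integrableOn_Ioi_Ptail_zero hα a).mono_set Ioc_subset_Ioi_self)
      measurableSet_Ioc fun x hx => Ptail_zero_antitone hα hx.2
  simp [hab] at hint
  linarith

lemma iteratedTail_nonneg {α : ℝ} (hα : 0 < α) (S : ℝ) : 0 ≤ iteratedTail α S :=
  integral_nonneg fun x => Ptail_nonneg hα 0 x

lemma iteratedTail_antitone {α : ℝ} (hα : 0 < α) : Antitone (iteratedTail α) := fun a b h => by
  have := mul_Ptail_le_iteratedTail_sub hα h
  have := mul_nonneg (sub_nonneg.2 h) (Ptail_nonneg hα 0 b)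
  linarith

lemma exp_le_Ptail_zero {α v : ℝ} (hα : 0 < α) (hv : 0 ≤ v) :
    C0 α * Real.exp (-((v + 1) ^ α)) ≤ Ptail α 0 v := by
  have hint : ∫ _ in Set.Ioc v (v + 1), C0 α * Real.exp (-((v + 1) ^ α)) ≤
      ∫ x in Set.Ioc v (v + 1), fd α 0 x := by
    refine setIntegral_mono_on (integrableOn_const measure_Ioc_lt_top.ne)
      (integrable_fd_zero hα).integrableOn
      measurableSet_Ioc fun x hx => ?_
    have hx0 : 0 ≤ x := hv.trans hx.1.le
    simp only [fd, sub_zero, abs_of_nonneg hx0]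
    have := C0_pos hα
    have := hx.2
    gcongr
  have hle : ∫ x in Set.Ioc v (v + 1), fd α 0 x ≤ Ptail α 0 v :=
    setIntegral_mono_set (integrable_fd_zero hα).integrableOn
      (Eventually.of_forall fun x => fd_nonneg hα 0 x) Ioc_subset_Ioi_self.eventuallyLE
  simp at hint
  linarith

lemma exp_le_iteratedTail {α v : ℝ} (hα : 0 < α) (hv : 0 ≤ v) :
    C0 α * Real.exp (-((v + 2) ^ α)) ≤ iteratedTail α v := by
  have h1 := mul_Ptail_le_iteratedTail_sub hα (show v ≤ v + 1 by linarith)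
  have h2 := exp_le_Ptail_zero hα (show 0 ≤ v + 1 by linarith)
  have h3 := iteratedTail_nonneg hα (v + 1)
  rw [show v + 1 + 1 = v + 2 by ring] at h2
  linarith

/-- Quantitative comparison of two solutions of the fixed-point equation, in centred coordinates:
the larger centred solution `b` has to lie far in the tail. -/
lemma centred_solution_sub_le {α k a b s t N : ℝ} (hα : 0 < α) (hk : 0 < k) (hab : a ≤ b)
    (hb : 0 < b) (hN1 : 1 < N) (hN : N + 1 ≤ α * b ^ α) (hbt : b / 2 ≤ b + t)
    (ha_eq : k * (a + s) = iteratedTail α a) (hb_eq : k * (b + t) = iteratedTail α b) :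
    (N - 1) / 2 * (b - a) ≤ s - t := by
  have h1 := iteratedTail_le hα hb hN1 hN
  have h2 := mul_Ptail_le_iteratedTail_sub hα hab
  have hP : k * ((N - 1) / 2) ≤ Ptail α 0 b := by
    refine le_of_mul_le_mul_left ?_ hb
    have : (N - 1) * (k * (b / 2)) ≤ (N - 1) * (k * (b + t)) := by
      have : 0 ≤ N - 1 := by linarith
      gcongr
    rw [← hb_eq] at h1
    linarith
  have h3 := mul_le_mul_of_nonneg_left hP (sub_nonneg.2 hab)
  rw [← ha_eq, ← hb_eq] at h2
  have h4 : 0 ≤ k * (b - a) := by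
    have := sub_nonneg.2 hab
    positivity
  refine le_of_mul_le_mul_left ?_ hk
  linarith

lemma le_centred_solution {α k r b t : ℝ} (hα : 0 < α) (hk : 0 < k) (hr : 0 ≤ r)
    (hsmall : k * (r + t) < C0 α * Real.exp (-((r + 2) ^ α)))
    (hb_eq : k * (b + t) = iteratedTail α b) : r ≤ b := by
  by_contra! h
  have h1 := iteratedTail_antitone hα h.le
  have h2 := exp_le_iteratedTail hα hr
  have : k * (b + t) ≤ k * (r + t) := by gcongr
  linarith

/-- A point of the order of `(log (1/(1-γ)))^{1/α}` lies below every centred solution. -/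
lemma eventually_mul_rpow_lt {α c M : ℝ} (hα : 0 < α) (hc : (2 * c) ^ α = 1 / 2) (hc0 : 0 < c) :
    ∀ᶠ l : ℝ in atTop, M ≤ c * l ^ (1 / α) ∧
      2 * Real.exp (-l) * (2 * c * l ^ (1 / α)) <
        C0 α * Real.exp (-((c * l ^ (1 / α) + 2) ^ α)) := by
  have hL : Tendsto (fun l : ℝ => c * l ^ (1 / α)) atTop atTop :=
    (tendsto_rpow_atTop (by positivity)).const_mul_atTop hc0
  have h0 := (tendsto_rpow_mul_exp_neg_mul_atTop_nhds_zero (1 / α) (1 / 2)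
    (by norm_num)).const_mul (4 * c)
  rw [mul_zero] at h0
  filter_upwards [hL.eventually_ge_atTop M, hL.eventually_ge_atTop 2, eventually_gt_atTop 0,
    h0.eventually_lt_const (C0_pos hα)] with l hM h2 hl hlt
  refine ⟨hM, ?_⟩
  have hLl : (l ^ (1 / α)) ^ α = l := by
    rw [← Real.rpow_mul hl.le, one_div_mul_cancel hα.ne', Real.rpow_one]
  have hpow : (c * l ^ (1 / α) + 2) ^ α ≤ 1 / 2 * l := by
    calc (c * l ^ (1 / α) + 2) ^ α ≤ (2 * c * l ^ (1 / α)) ^ α := by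
          gcongr
          linarith
      _ = 1 / 2 * l := by rw [Real.mul_rpow (by positivity) (by positivity), hc, hLl]
  have hexp : Real.exp (-l) = Real.exp (-(1 / 2) * l) * Real.exp (-(1 / 2 * l)) := by
    rw [← Real.exp_add]; ring_nf
  calc 2 * Real.exp (-l) * (2 * c * l ^ (1 / α))
      = 4 * c * (l ^ (1 / α) * Real.exp (-(1 / 2) * l)) * Real.exp (-(1 / 2 * l)) := by
        rw [hexp]; ring
    _ < C0 α * Real.exp (-(1 / 2 * l)) := by gcongr
    _ ≤ C0 α * Real.exp (-((c * l ^ (1 / α) + 2) ^ α)) := by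
        have := C0_pos hα
        gcongr

/-- Location shift of the optimal threshold: for every `c₀ > 0`, eventually in `γ`,
`|S*(θ,γ) − S*(θ₀,γ) − (θ−θ₀)| ≤ c₀·|θ−θ₀|` uniformly for `θ ∈ [θ₀−f(γ), θ₀+f(γ)]`. -/
theorem stmt_11 (α : ℝ) (hα : 1/2 ≤ α) (θ₀ : ℝ)
    (Sstar : ℝ → ℝ → ℝ)
    (hS : ∀ θ : ℝ, ∀ γ ∈ Set.Ioo (0:ℝ) 1,
      0 < Sstar θ γ ∧
      ((1-γ)/γ) * Sstar θ γ = (∫ x in Set.Ioi (Sstar θ γ), Ptail α θ x) ∧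
      ∀ S, 0 < S → ((1-γ)/γ) * S = (∫ x in Set.Ioi S, Ptail α θ x) → S = Sstar θ γ)
    (f : ℝ → ℝ) (hf0 : ∀ γ, 0 ≤ f γ)
    (hf : Tendsto (fun γ => f γ / (Real.log (1/(1-γ))) ^ (1/α)) (𝓝[<] (1:ℝ)) (𝓝 0)) :
    ∀ c₀ > 0, ∃ γ₀ ∈ Set.Ioo (0:ℝ) 1, ∀ γ, γ₀ ≤ γ → γ < 1 →
      ∀ θ ∈ Set.Icc (θ₀ - f γ) (θ₀ + f γ),
        |Sstar θ γ - Sstar θ₀ γ - (θ - θ₀)| ≤ c₀ * |θ - θ₀| := by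
  intro c₀ hc₀
  have hα0 : 0 < α := by linarith
  obtain ⟨c, hc0, hc⟩ : ∃ c : ℝ, 0 < c ∧ (2 * c) ^ α = 1 / 2 := by
    refine ⟨(1 / 2) ^ (1 / α) / 2, by positivity, ?_⟩
    rw [mul_div_cancel₀ _ two_ne_zero, ← Real.rpow_mul (by norm_num),
      one_div_mul_cancel hα0.ne', Real.rpow_one]
  set N : ℝ := 1 + 2 / c₀ with hN
  have hN1 : 1 < N := by
    have : 0 < 2 / c₀ := by positivity
    linarith
  obtain ⟨V, hV⟩ := eventually_atTop.1
    (((tendsto_rpow_atTop hα0).const_mul_atTop hα0).eventually_ge_atTop (N + 1))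
  have hlog : Tendsto (fun γ : ℝ => Real.log (1 / (1 - γ))) (𝓝[<] 1) atTop := by
    refine Real.tendsto_log_atTop.comp ?_
    simp_rw [one_div]
    refine tendsto_inv_nhdsGT_zero.comp (tendsto_nhdsWithin_iff.2 ⟨?_, ?_⟩)
    · refine Tendsto.mono_left ?_ nhdsWithin_le_nhds
      exact (continuous_const.sub continuous_id).tendsto' _ _ (by simp)
    · filter_upwards [self_mem_nhdsWithin] with γ hγ
      exact sub_pos.2 (mem_Iio.1 hγ)
  have hev : ∀ᶠ γ in 𝓝[<] (1 : ℝ), ∀ θ ∈ Set.Icc (θ₀ - f γ) (θ₀ + f γ),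
      |Sstar θ γ - Sstar θ₀ γ - (θ - θ₀)| ≤ c₀ * |θ - θ₀| := by
    filter_upwards [hlog.eventually (eventually_mul_rpow_lt (M := max (max V 1) (4 * |θ₀|))
      hα0 hc hc0), hf.eventually_lt_const (show 0 < c / 4 by positivity),
      Ioo_mem_nhdsLT (show (1 / 2 : ℝ) < 1 by norm_num)] with γ hγ hfγ hγI θ hθ
    obtain ⟨hM, hlt⟩ := hγ
    have h1γ : 0 < 1 - γ := sub_pos.2 hγI.2
    have hγ0 : 0 < γ := by linarith [hγI.1]
    set r := c * Real.log (1 / (1 - γ)) ^ (1 / α) with hr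
    have hVr : V ≤ r := (le_max_left _ _).trans ((le_max_left _ _).trans hM)
    have h1r : 1 ≤ r := (le_max_right _ _).trans ((le_max_left _ _).trans hM)
    have hθ₀r : 4 * |θ₀| ≤ r := (le_max_right _ _).trans hM
    have hLpos : 0 < Real.log (1 / (1 - γ)) ^ (1 / α) := by
      by_contra! h
      nlinarith
    have hfr : f γ ≤ r / 4 := by
      rw [div_lt_iff₀ hLpos] at hfγ
      linarith
    have hk : 0 < (1 - γ) / γ := by positivity
    have hk2 : (1 - γ) / γ ≤ 2 * Real.exp (-Real.log (1 / (1 - γ))) := by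
      rw [one_div, Real.log_inv, neg_neg, Real.exp_log h1γ, div_le_iff₀ hγ0]
      nlinarith [hγI.1]
    have hshift : ∀ t, |t - θ₀| ≤ f γ → |t| ≤ r / 2 := fun t ht => by
      have := abs_sub_abs_le_abs_sub t θ₀
      linarith
    have heq : ∀ t, (1 - γ) / γ * (Sstar t γ - t + t) = iteratedTail α (Sstar t γ - t) :=
      fun t => by
        rw [sub_add_cancel, ← setIntegral_Ptail_eq]
        exact (hS t γ ⟨hγ0, hγI.2⟩).2.1
    have hlow : ∀ t, |t - θ₀| ≤ f γ → r ≤ Sstar t γ - t := fun t ht => by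
      refine le_centred_solution hα0 hk (by linarith) (lt_of_le_of_lt ?_ hlt) (heq t)
      have h1 := hshift t ht
      have h2 := neg_abs_le t
      have h3 := le_abs_self t
      have : r + t ≤ 2 * c * Real.log (1 / (1 - γ)) ^ (1 / α) := by linarith
      have : 0 ≤ r + t := by linarith
      gcongr
    have hcmp : ∀ s t, |t - θ₀| ≤ f γ → Sstar s γ - s ≤ Sstar t γ - t →
        (Sstar t γ - t) - (Sstar s γ - s) ≤ c₀ * (s - t) := fun s t ht hst => by
      have h1 := hlow t ht
      have h2 := hshift t ht
      have h3 := neg_abs_le t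
      have h4 := centred_solution_sub_le hα0 hk hst (by linarith) hN1 (hV _ (by linarith))
        (by linarith) (heq s) (heq t)
      rw [hN, show (1 + 2 / c₀ - 1) / 2 = 1 / c₀ by ring, one_div_mul_eq_div,
        div_le_iff₀ hc₀] at h4
      linarith
    have hθf : |θ - θ₀| ≤ f γ := by
      rw [abs_le]
      constructor <;> linarith [hθ.1, hθ.2]
    have hθ₀f : |θ₀ - θ₀| ≤ f γ := by simpa using hf0 γ
    rcases le_total (Sstar θ γ - θ) (Sstar θ₀ γ - θ₀) with h | h
    · have := hcmp θ θ₀ hθ₀f h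
      have := mul_le_mul_of_nonneg_left (le_abs_self (θ - θ₀)) hc₀.le
      rw [abs_of_nonpos (by linarith)]
      linarith
    · have := hcmp θ₀ θ hθf h
      have := mul_le_mul_of_nonneg_left (neg_abs_le (θ - θ₀)) hc₀.le
      rw [abs_of_nonneg (by linarith)]
      linarith
  obtain ⟨a, ha1, ha⟩ := mem_nhdsLT_iff_exists_Ioo_subset.1 hev
  have ha1 : a < 1 := ha1
  refine ⟨(max a 0 + 1) / 2, ⟨?_, ?_⟩, fun γ hγ hγ1 => ha ⟨?_, hγ1⟩⟩
  · linarith [le_max_right a 0]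
  · linarith [max_lt ha1 one_pos]
  · linarith [max_lt ha1 one_pos, le_max_left a 0]
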